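/- Suppose V̂ satisfies the Bellman equation for π, and define the advantage A(a,s₀) = r(s₀,a) + γ·Σ_{s'} P(s'|s₀,a)·V̂(s') − V̂(s₀). Then for any two distinct actions a ≠ a': cov_π(Â^δHCA_N(a), Â^δHCA_N(a') | S_0 = s) = Σ_{k=1}^{N−1} γ^{2k}·E_π[(p_k(a|s,S_k)/π(a|s))·(p_k(a'|s,S_k)/π(a'|s))·δ_k² | S_0 = s] − A(a,s)·A(a',s). -/

import Mathlib

open Finset

attribute [local instance] Classical.propDecidable

namespace HCA

/-- A trajectory of horizon `N`: the actions taken at steps `0, …, N-1` and the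
states reached after each step (the start state is fixed separately). -/
abbrev Traj (S A : Type*) (N : ℕ) : Type _ := (Fin N → A) × (Fin N → S)

variable {S A : Type*} [Fintype S] [Fintype A] [Nonempty S] [Nonempty A]

/-- The state `S_k` of a trajectory with start state `s`. -/
def st {N : ℕ} (s : S) (τ : Traj S A N) : ℕ → S
  | 0 => s
  | k + 1 => if h : k < N then τ.2 ⟨k, h⟩ else s

/-- The action `A_k` of a trajectory. -/
noncomputable def ac {N : ℕ} (τ : Traj S A N) (k : ℕ) : A :=
  if h : k < N then τ.1 ⟨k, h⟩ else Classical.arbitrary A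

/-- The probability `P_π(τ) = ∏_{k=0}^{N-1} π(A_k|S_k)·P(S_{k+1}|S_k,A_k)` of a
trajectory starting at `s`. -/
noncomputable def trajP (π : S → A → ℝ) (P : S → A → S → ℝ) (s : S) (N : ℕ)
    (τ : Traj S A N) : ℝ :=
  ∏ k : Fin N, π (st s τ k) (τ.1 k) * P (st s τ k) (τ.1 k) (st s τ (k + 1))

/-- Expectation `E_π[f | S_0 = s]` over trajectories. -/
noncomputable def expct (π : S → A → ℝ) (P : S → A → S → ℝ) (s : S) (N : ℕ)
    (f : Traj S A N → ℝ) : ℝ :=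
  ∑ τ : Traj S A N, trajP π P s N τ * f τ

/-- Variance `Var_π(f | S_0 = s)` over trajectories. -/
noncomputable def vr (π : S → A → ℝ) (P : S → A → S → ℝ) (s : S) (N : ℕ)
    (f : Traj S A N → ℝ) : ℝ :=
  expct π P s N (fun τ => (f τ - expct π P s N f) ^ 2)

/-- Covariance `cov_π(f, g | S_0 = s)` over trajectories. -/
noncomputable def cv (π : S → A → ℝ) (P : S → A → S → ℝ) (s : S) (N : ℕ)
    (f g : Traj S A N → ℝ) : ℝ :=
  expct π P s N (fun τ => (f τ - expct π P s N f) * (g τ - expct π P s N g))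

/-- Probability `P_π(E | S_0 = s)` of an event `E` on trajectories. -/
noncomputable def prE (π : S → A → ℝ) (P : S → A → S → ℝ) (s : S) (N : ℕ)
    (E : Traj S A N → Prop) : ℝ :=
  ∑ τ : Traj S A N, if E τ then trajP π P s N τ else 0

/-- The TD error `δ_k = r(S_k,A_k) + γ·V̂(S_{k+1}) − V̂(S_k)`. -/
noncomputable def td (r : S → A → ℝ) (γ : ℝ) (V : S → ℝ) (s : S) {N : ℕ}
    (τ : Traj S A N) (k : ℕ) : ℝ :=
  r (st s τ k) (ac τ k) + γ * V (st s τ (k + 1)) - V (st s τ k)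

/-- `p_k(s'|s,a) = P_π(S_k = s' | S_0 = s, A_0 = a)
  = P_π(A_0 = a, S_k = s' | S_0 = s) / π(a|s)`. -/
noncomputable def pkSA (π : S → A → ℝ) (P : S → A → S → ℝ) (s : S) (N k : ℕ)
    (a : A) (s' : S) : ℝ :=
  prE π P s N (fun τ => ac τ 0 = a ∧ st s τ k = s') / π s a

/-- `p_k(s'|s) = Σ_a π(a|s)·p_k(s'|s,a)`. -/
noncomputable def pkS (π : S → A → ℝ) (P : S → A → S → ℝ) (s : S) (N k : ℕ)
    (s' : S) : ℝ :=
  ∑ a : A, π s a * pkSA π P s N k a s'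

/-- The hindsight probability `p_k(a|s,s')`, defined as
`P_π(A_0 = a, S_k = s' | S_0 = s)/p_k(s'|s)` when `p_k(s'|s) > 0` and `0` otherwise. -/
noncomputable def pkA (π : S → A → ℝ) (P : S → A → S → ℝ) (s : S) (N k : ℕ)
    (a : A) (s' : S) : ℝ :=
  if 0 < pkS π P s N k s' then
    prE π P s N (fun τ => ac τ 0 = a ∧ st s τ k = s') / pkS π P s N k s'
  else 0

/-- The `N`-step Monte-Carlo advantage estimator
`Â^MC_N(a) = (1(A_0=a)/π(a|s))·Σ_{k=0}^{N−1} γ^k·δ_k`. -/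
noncomputable def mcEst (π : S → A → ℝ) (r : S → A → ℝ) (γ : ℝ) (V : S → ℝ)
    (s : S) (N : ℕ) (a : A) (τ : Traj S A N) : ℝ :=
  ((if ac τ 0 = a then (1 : ℝ) else 0) / π s a) * ∑ k ∈ range N, γ ^ k * td r γ V s τ k

/-- The `N`-step δHCA advantage estimator
`Â^δHCA_N(a) = (1(A_0=a)/π(a|s))·δ_0 + Σ_{k=1}^{N−1} γ^k·(p_k(a|s,S_k)/π(a|s))·δ_k`. -/
noncomputable def dhcaEst (π : S → A → ℝ) (P : S → A → S → ℝ) (r : S → A → ℝ)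
    (γ : ℝ) (V : S → ℝ) (s : S) (N : ℕ) (a : A) (τ : Traj S A N) : ℝ :=
  ((if ac τ 0 = a then (1 : ℝ) else 0) / π s a) * td r γ V s τ 0
    + ∑ k ∈ Ico 1 N, γ ^ k * (pkA π P s N k a (st s τ k) / π s a) * td r γ V s τ k

/-- `V` satisfies the Bellman equation for `π`:
`V(s₀) = Σ_a π(a|s₀)·(r(s₀,a) + γ·Σ_{s'} P(s'|s₀,a)·V(s'))` for every state `s₀`. -/
def IsBellman (π : S → A → ℝ) (P : S → A → S → ℝ) (r : S → A → ℝ) (γ : ℝ)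
    (V : S → ℝ) : Prop :=
  ∀ s₀ : S, V s₀ = ∑ a : A, π s₀ a * (r s₀ a + γ * ∑ s' : S, P s₀ a s' * V s')

/-- The conditional second moment `E_π[δ_k² | S_0 = s, S_k = s']`,
defined as `(Σ_{τ : S_k = s'} P_π(τ)·δ_k(τ)²)/p_k(s'|s)`. -/
noncomputable def sndMom (π : S → A → ℝ) (P : S → A → S → ℝ) (r : S → A → ℝ)
    (γ : ℝ) (V : S → ℝ) (s : S) (N k : ℕ) (s' : S) : ℝ :=
  (∑ τ : Traj S A N, if st s τ k = s' then trajP π P s N τ * (td r γ V s τ k) ^ 2 else 0)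
    / pkS π P s N k s'

/-- Prepend a first action and a first reached state to a trajectory. -/
def consT {S A : Type*} {M : ℕ} (a : A) (x : S) (τ : Traj S A M) : Traj S A (M + 1) :=
  (Fin.cons a τ.1, Fin.cons x τ.2)

theorem st_consT {S A : Type*} {M : ℕ} (s : S) (a : A) (x : S) (τ : Traj S A M) (k : ℕ)
    (hk : k ≤ M) : st s (consT a x τ) (k + 1) = st x τ k := by
  cases k with
  | zero => simp [st, consT]
  | succ k =>
    have h1 : k < M := hk
    have h2 : k + 1 < M + 1 := by omega
    simp only [st, consT, h1, h2, dif_pos]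
    exact Fin.cons_succ (α := fun _ => S) x τ.2 ⟨k, h1⟩

theorem ac_consT_zero {S A : Type*} [Nonempty A] {M : ℕ} (a : A) (x : S) (τ : Traj S A M) :
    ac (consT a x τ) 0 = a := by
  simp [ac, consT]

theorem ac_consT_succ {S A : Type*} [Nonempty A] {M : ℕ} (a : A) (x : S) (τ : Traj S A M)
    (k : ℕ) (hk : k < M) : ac (consT a x τ) (k + 1) = ac τ k := by
  have h2 : k + 1 < M + 1 := by omega
  simp only [ac, consT, hk, h2, dif_pos]
  exact Fin.cons_succ (α := fun _ => A) a τ.1 ⟨k, hk⟩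

theorem trajP_consT {S A : Type*} (π : S → A → ℝ)
    (P : S → A → S → ℝ) (s : S) (M : ℕ) (a : A) (x : S) (τ : Traj S A M) :
    trajP π P s (M + 1) (consT a x τ) = π s a * P s a x * trajP π P x M τ := by
  unfold trajP
  rw [Fin.prod_univ_succ]
  congr 1
  refine Finset.prod_congr rfl fun i _ => ?_
  have h1 : st s (consT a x τ) ((i.succ : Fin (M + 1)) : ℕ) = st x τ i := by
    rw [Fin.val_succ]; exact st_consT s a x τ i i.2.le
  have h2 : st s (consT a x τ) (((i.succ : Fin (M + 1)) : ℕ) + 1) = st x τ (i + 1) := by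
    rw [Fin.val_succ]; exact st_consT s a x τ (i + 1) i.2
  have h3 : (consT a x τ).1 i.succ = τ.1 i := by simp [consT]
  rw [h1, h2, h3]

/-- Bijection between long trajectories and (action, state, shorter trajectory). -/
def consEquiv (S A : Type*) (M : ℕ) : (A × S) × Traj S A M ≃ Traj S A (M + 1) where
  toFun p := consT p.1.1 p.1.2 p.2
  invFun τ := ((τ.1 0, τ.2 0), (Fin.tail τ.1, Fin.tail τ.2))
  left_inv p := by simp [consT]
  right_inv τ := by simp [consT]

theorem expct_succ {S A : Type*} [Fintype S] [Fintype A] (π : S → A → ℝ)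
    (P : S → A → S → ℝ) (s : S) (M : ℕ) (f : Traj S A (M + 1) → ℝ) :
    expct π P s (M + 1) f
      = ∑ a : A, ∑ x : S, π s a * P s a x * expct π P x M (fun τ => f (consT a x τ)) := by
  unfold expct
  rw [← (consEquiv S A M).sum_comp, Fintype.sum_prod_type, Fintype.sum_prod_type]
  refine Finset.sum_congr rfl fun a _ => Finset.sum_congr rfl fun x _ => ?_
  rw [Finset.mul_sum]
  refine Finset.sum_congr rfl fun τ _ => ?_
  change trajP π P s (M + 1) (consT a x τ) * f (consT a x τ) = _
  rw [trajP_consT]; ring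

theorem expct_const {S A : Type*} [Fintype S] [Fintype A] (π : S → A → ℝ)
    (P : S → A → S → ℝ) (hπsum : ∀ s₀ : S, ∑ a : A, π s₀ a = 1)
    (hPsum : ∀ (s₀ : S) (a : A), ∑ s' : S, P s₀ a s' = 1) (c : ℝ) (N : ℕ) (s : S) :
    expct π P s N (fun _ => c) = c := by
  induction N generalizing s with
  | zero => simp [expct, trajP]
  | succ M ih =>
    rw [expct_succ]
    simp only [ih, ← Finset.sum_mul, ← Finset.mul_sum, hPsum, hπsum, mul_one, one_mul]

/-- Agreement of trajectories up to step `k`. -/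
def Agree {S A : Type*} {N : ℕ} (k : ℕ) (τ τ' : Traj S A N) : Prop :=
  ∀ i : Fin N, (i : ℕ) < k → τ.1 i = τ'.1 i ∧ τ.2 i = τ'.2 i

theorem Agree.st {S A : Type*} {N : ℕ} {k : ℕ} {τ τ' : Traj S A N} (h : Agree k τ τ')
    (s : S) (j : ℕ) (hj : j ≤ k) : st s τ j = st s τ' j := by
  cases j with
  | zero => rfl
  | succ j =>
    by_cases hN : j < N
    · simp only [HCA.st, hN, dif_pos]; exact (h ⟨j, hN⟩ hj).2
    · simp [HCA.st, hN]

theorem Agree.ac {S A : Type*} [Nonempty A] {N : ℕ} {k : ℕ} {τ τ' : Traj S A N}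
    (h : Agree k τ τ') (j : ℕ) (hj : j < k) : ac τ j = ac τ' j := by
  by_cases hN : j < N
  · simp only [HCA.ac, hN, dif_pos]; exact (h ⟨j, hN⟩ hj).1
  · simp [HCA.ac, hN]

theorem Agree.td {S A : Type*} [Nonempty A] {N : ℕ} {k : ℕ} {τ τ' : Traj S A N}
    (h : Agree k τ τ') (r : S → A → ℝ) (γ : ℝ) (V : S → ℝ) (s : S) (j : ℕ) (hj : j < k) :
    td r γ V s τ j = td r γ V s τ' j := by
  simp only [HCA.td, h.st s j hj.le, h.st s (j + 1) hj, h.ac j hj]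

theorem Agree.consT {S A : Type*} {M : ℕ} {k : ℕ} {τ τ' : Traj S A M}
    (h : Agree k τ τ') (a : A) (x : S) : Agree (k + 1) (consT a x τ) (consT a x τ') := by
  intro i
  refine Fin.cases ?_ (fun i => ?_) i
  · intro _; simp [HCA.consT]
  · intro hi
    have := h i (by simpa using hi)
    simpa [HCA.consT] using this

theorem td_consT_zero {S A : Type*} [Nonempty A] {M : ℕ} (r : S → A → ℝ) (γ : ℝ) (V : S → ℝ)
    (s : S) (a : A) (x : S) (τ : Traj S A M) :
    td r γ V s (consT a x τ) 0 = r s a + γ * V x - V s := by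
  unfold td
  rw [ac_consT_zero, st_consT s a x τ 0 (Nat.zero_le _)]
  rfl

theorem td_consT_succ {S A : Type*} [Nonempty A] {M : ℕ} (r : S → A → ℝ) (γ : ℝ) (V : S → ℝ)
    (s : S) (a : A) (x : S) (τ : Traj S A M) (k : ℕ) (hk : k < M) :
    td r γ V s (consT a x τ) (k + 1) = td r γ V x τ k := by
  unfold td
  rw [ac_consT_succ a x τ k hk, st_consT s a x τ k hk.le, st_consT s a x τ (k + 1) hk]

theorem inner_sum {S A : Type*} [Fintype S] (P : S → A → S → ℝ) (r : S → A → ℝ) (γ : ℝ)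
    (hPsum : ∀ (s₀ : S) (a : A), ∑ s' : S, P s₀ a s' = 1) (V : S → ℝ) (s : S) (a : A) :
    ∑ x : S, P s a x * (r s a + γ * V x - V s)
      = r s a + γ * ∑ x : S, P s a x * V x - V s := by
  have : ∀ x, P s a x * (r s a + γ * V x - V s)
      = P s a x * (r s a - V s) + γ * (P s a x * V x) := fun x => by ring
  simp only [this, Finset.sum_add_distrib, ← Finset.sum_mul, ← Finset.mul_sum, hPsum]
  ring

/-- The TD error is a martingale difference. -/
theorem expct_mul_td {S A : Type*} [Fintype S] [Fintype A] [Nonempty A]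
    (π : S → A → ℝ) (P : S → A → S → ℝ) (r : S → A → ℝ) (γ : ℝ)
    (hπsum : ∀ s₀ : S, ∑ a : A, π s₀ a = 1)
    (hPsum : ∀ (s₀ : S) (a : A), ∑ s' : S, P s₀ a s' = 1)
    (V : S → ℝ) (hV : IsBellman π P r γ V) (k : ℕ) :
    ∀ (N : ℕ) (s : S) (g : Traj S A N → ℝ), k < N →
      (∀ τ τ', Agree k τ τ' → g τ = g τ') →
      expct π P s N (fun τ => g τ * td r γ V s τ k) = 0 := by
  induction k with
  | zero =>
    intro N s g hN hg
    obtain ⟨M, rfl⟩ : ∃ M, N = M + 1 := ⟨N - 1, by omega⟩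
    obtain ⟨c, hc⟩ : ∃ c, ∀ τ, g τ = c :=
      ⟨g (fun _ => Classical.arbitrary A, fun _ => s), fun τ => hg _ _ fun i hi => by omega⟩
    rw [expct_succ]
    simp only [hc, td_consT_zero, expct_const π P hπsum hPsum]
    have h1 : ∀ a, ∑ x : S, π s a * P s a x * (c * (r s a + γ * V x - V s))
        = c * (π s a * (r s a + γ * ∑ x : S, P s a x * V x)) - c * (π s a * V s) := by
      intro a
      have := inner_sum P r γ hPsum V s a
      calc _ = c * (π s a * ∑ x : S, P s a x * (r s a + γ * V x - V s)) := by
            rw [Finset.mul_sum, Finset.mul_sum]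
            exact Finset.sum_congr rfl fun x _ => by ring
        _ = _ := by rw [this]; ring
    simp only [h1, Finset.sum_sub_distrib, ← Finset.mul_sum, ← Finset.sum_mul, hπsum]
    rw [← hV s]; ring
  | succ k ih =>
    intro N s g hN hg
    obtain ⟨M, rfl⟩ : ∃ M, N = M + 1 := ⟨N - 1, by omega⟩
    have hk : k < M := by omega
    rw [expct_succ]
    refine Finset.sum_eq_zero fun a _ => Finset.sum_eq_zero fun x _ => ?_
    simp only [td_consT_succ r γ V s a x _ k hk]
    rw [ih M x (fun τ => g (consT a x τ)) hk fun τ τ' h => hg _ _ (h.consT a x), mul_zero]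

theorem expct_td_zero {S A : Type*} [Fintype S] [Fintype A] [Nonempty A]
    (π : S → A → ℝ) (P : S → A → S → ℝ) (r : S → A → ℝ) (γ : ℝ)
    (hπpos : ∀ s₀ a, 0 < π s₀ a) (hπsum : ∀ s₀ : S, ∑ a : A, π s₀ a = 1)
    (hPsum : ∀ (s₀ : S) (a : A), ∑ s' : S, P s₀ a s' = 1)
    (V : S → ℝ) (N : ℕ) (hN : 1 ≤ N) (s : S) (a : A) :
    expct π P s N (fun τ => ((if ac τ 0 = a then (1 : ℝ) else 0) / π s a) * td r γ V s τ 0)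
      = r s a + γ * ∑ x : S, P s a x * V x - V s := by
  obtain ⟨M, rfl⟩ : ∃ M, N = M + 1 := ⟨N - 1, by omega⟩
  rw [expct_succ]
  simp only [td_consT_zero, ac_consT_zero, expct_const π P hπsum hPsum]
  rw [Finset.sum_eq_single a]
  · rw [← inner_sum P r γ hPsum V s a]
    refine Finset.sum_congr rfl fun x _ => ?_
    have := (hπpos s a).ne'
    simp only [if_true]
    field_simp
  · intro b _ hb
    simp [hb]
  · simp

theorem expct_sum {S A : Type*} [Fintype S] [Fintype A] (π : S → A → ℝ)
    (P : S → A → S → ℝ) (s : S) (N : ℕ) {ι : Type*} (I : Finset ι) (f : ι → Traj S A N → ℝ) :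
    expct π P s N (fun τ => ∑ i ∈ I, f i τ) = ∑ i ∈ I, expct π P s N (f i) := by
  unfold expct
  simp only [Finset.mul_sum]
  exact Finset.sum_comm

theorem cv_eq {S A : Type*} [Fintype S] [Fintype A] (π : S → A → ℝ)
    (P : S → A → S → ℝ) (hπsum : ∀ s₀ : S, ∑ a : A, π s₀ a = 1)
    (hPsum : ∀ (s₀ : S) (a : A), ∑ s' : S, P s₀ a s' = 1) (N : ℕ) (s : S)
    (f g : Traj S A N → ℝ) :
    cv π P s N f g
      = expct π P s N (fun τ => f τ * g τ) - expct π P s N f * expct π P s N g := by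
  have h1 := expct_const π P hπsum hPsum 1 N s
  unfold cv
  generalize hf : expct π P s N f = F
  generalize hg : expct π P s N g = G
  unfold expct at *
  have : ∀ τ, trajP π P s N τ * ((f τ - F) * (g τ - G))
      = trajP π P s N τ * (f τ * g τ) - G * (trajP π P s N τ * f τ)
        - F * (trajP π P s N τ * g τ) + F * G * (trajP π P s N τ * 1) := fun τ => by ring
  simp only [this, Finset.sum_add_distrib, Finset.sum_sub_distrib, ← Finset.mul_sum, hf, hg, h1]
  ring

/-- Weight multiplying the `k`-th TD error in the estimator. -/
noncomputable def wt {S A : Type*} [Fintype S] [Fintype A] [Nonempty A]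
    (π : S → A → ℝ) (P : S → A → S → ℝ) (γ : ℝ) (s : S) (N : ℕ) (a : A) (k : ℕ)
    (τ : Traj S A N) : ℝ :=
  if k = 0 then (if ac τ 0 = a then (1 : ℝ) else 0) / π s a
  else γ ^ k * (pkA π P s N k a (st s τ k) / π s a)

theorem dhcaEst_eq {S A : Type*} [Fintype S] [Fintype A] [Nonempty A]
    (π : S → A → ℝ) (P : S → A → S → ℝ) (r : S → A → ℝ) (γ : ℝ) (V : S → ℝ) (s : S) (N : ℕ)
    (hN : 1 ≤ N) (a : A) (τ : Traj S A N) :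
    dhcaEst π P r γ V s N a τ
      = ∑ k ∈ range N, wt π P γ s N a k τ * td r γ V s τ k := by
  rw [Finset.range_eq_Ico, Finset.sum_eq_sum_Ico_succ_bot (by omega)]
  unfold dhcaEst
  congr 1
  refine Finset.sum_congr rfl fun k hk => ?_
  have : k ≠ 0 := by have := Finset.mem_Ico.1 hk; omega
  simp [wt, this]

theorem Agree.wt {S A : Type*} [Fintype S] [Fintype A] [Nonempty A] {N : ℕ} {k : ℕ}
    {τ τ' : Traj S A N} (h : Agree k τ τ') (π : S → A → ℝ) (P : S → A → S → ℝ) (γ : ℝ) (s : S)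
    (a : A) (j : ℕ) (hj : j ≤ k) (hk : 0 < k) : wt π P γ s N a j τ = wt π P γ s N a j τ' := by
  simp only [HCA.wt, h.st s j hj, h.ac 0 hk]

theorem expct_cross {S A : Type*} [Fintype S] [Fintype A] [Nonempty A]
    (π : S → A → ℝ) (P : S → A → S → ℝ) (r : S → A → ℝ) (γ : ℝ)
    (hπsum : ∀ s₀ : S, ∑ a : A, π s₀ a = 1)
    (hPsum : ∀ (s₀ : S) (a : A), ∑ s' : S, P s₀ a s' = 1)
    (V : S → ℝ) (hV : IsBellman π P r γ V) (N : ℕ) (s : S) (a a' : A) (j k : ℕ)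
    (hjk : j < k) (hk : k < N) :
    expct π P s N (fun τ => (wt π P γ s N a j τ * td r γ V s τ j)
      * (wt π P γ s N a' k τ * td r γ V s τ k)) = 0 := by
  have := expct_mul_td π P r γ hπsum hPsum V hV k N s
    (fun τ => (wt π P γ s N a j τ * td r γ V s τ j) * wt π P γ s N a' k τ) hk
    (fun τ τ' h => by
      simp only [h.wt π P γ s a j hjk.le (by omega), h.wt π P γ s a' k le_rfl (by omega),
        h.td r γ V s j hjk])
  simpa only [mul_assoc] using this

theorem expct_dhca {S A : Type*} [Fintype S] [Fintype A] [Nonempty A]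
    (π : S → A → ℝ) (P : S → A → S → ℝ) (r : S → A → ℝ) (γ : ℝ)
    (hπpos : ∀ s₀ a, 0 < π s₀ a) (hπsum : ∀ s₀ : S, ∑ a : A, π s₀ a = 1)
    (hPsum : ∀ (s₀ : S) (a : A), ∑ s' : S, P s₀ a s' = 1)
    (V : S → ℝ) (hV : IsBellman π P r γ V) (N : ℕ) (hN : 1 ≤ N) (s : S) (a : A) :
    expct π P s N (dhcaEst π P r γ V s N a) = r s a + γ * ∑ x : S, P s a x * V x - V s := by
  rw [funext (dhcaEst_eq π P r γ V s N hN a), expct_sum, Finset.sum_eq_single 0]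
  · rw [← expct_td_zero π P r γ hπpos hπsum hPsum V N hN s a]
    simp only [wt, if_true]
  · intro k hk hk0
    exact expct_mul_td π P r γ hπsum hPsum V hV k N s (wt π P γ s N a k)
      (Finset.mem_range.1 hk)
      (fun τ τ' h => h.wt π P γ s a k le_rfl (Nat.pos_of_ne_zero hk0))
  · intro h; exact absurd (Finset.mem_range.2 hN) h

theorem stmt_12 {S A : Type*} [Fintype S] [Fintype A] [Nonempty S] [Nonempty A]
    (π : S → A → ℝ) (P : S → A → S → ℝ) (r : S → A → ℝ) (γ : ℝ)
    (N : ℕ) (s : S)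
    (hπpos : ∀ s₀ a, 0 < π s₀ a) (hπsum : ∀ s₀ : S, ∑ a : A, π s₀ a = 1)
    (hPnn : ∀ s₀ a s', 0 ≤ P s₀ a s') (hPsum : ∀ (s₀ : S) (a : A), ∑ s' : S, P s₀ a s' = 1)
    (hγ0 : 0 ≤ γ) (hγ1 : γ ≤ 1) (hN : 1 ≤ N)
    (V : S → ℝ) (hV : IsBellman π P r γ V)
    (a a' : A) (hne : a ≠ a') :
    cv π P s N (dhcaEst π P r γ V s N a) (dhcaEst π P r γ V s N a')
      = (∑ k ∈ Ico 1 N, γ ^ (2 * k) *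
          expct π P s N (fun τ => pkA π P s N k a (st s τ k) / π s a
            * (pkA π P s N k a' (st s τ k) / π s a') * (td r γ V s τ k) ^ 2))
        - (r s a + γ * ∑ x : S, P s a x * V x - V s)
          * (r s a' + γ * ∑ x : S, P s a' x * V x - V s) := by
  rw [cv_eq π P hπsum hPsum, expct_dhca π P r γ hπpos hπsum hPsum V hV N hN s a,
    expct_dhca π P r γ hπpos hπsum hPsum V hV N hN s a']
  congr 1
  simp only [dhcaEst_eq π P r γ V s N hN, Finset.sum_mul_sum]
  rw [expct_sum]
  simp only [expct_sum]
  have hdiag : ∀ j ∈ range N, ∑ k ∈ range N,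
      expct π P s N (fun τ => (wt π P γ s N a j τ * td r γ V s τ j)
        * (wt π P γ s N a' k τ * td r γ V s τ k))
      = expct π P s N (fun τ => (wt π P γ s N a j τ * td r γ V s τ j)
        * (wt π P γ s N a' j τ * td r γ V s τ j)) := by
    intro j hj
    refine Finset.sum_eq_single j ?_ (fun h => absurd hj h)
    intro k hk hkj
    rcases lt_or_gt_of_ne hkj with h | h
    · have := expct_cross π P r γ hπsum hPsum V hV N s a' a k j h (Finset.mem_range.1 hj)
      simpa only [mul_comm (wt π P γ s N a' k _ * _)] using this
    · exact expct_cross π P r γ hπsum hPsum V hV N s a a' j k h (Finset.mem_range.1 hk)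
  rw [Finset.sum_congr rfl hdiag, Finset.range_eq_Ico,
    Finset.sum_eq_sum_Ico_succ_bot (by omega)]
  have h0 : expct π P s N (fun τ => (wt π P γ s N a 0 τ * td r γ V s τ 0)
        * (wt π P γ s N a' 0 τ * td r γ V s τ 0)) = 0 := by
    unfold expct
    refine Finset.sum_eq_zero fun τ _ => ?_
    by_cases h : ac τ 0 = a
    · have h' : ac τ 0 ≠ a' := fun h2 => hne (h.symm.trans h2)
      simp [wt, h']
    · simp [wt, h]
  rw [h0, zero_add]
  refine Finset.sum_congr rfl fun k hk => ?_
  have hk0 : k ≠ 0 := by have := Finset.mem_Ico.1 hk; omega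
  unfold expct
  rw [Finset.mul_sum]
  refine Finset.sum_congr rfl fun τ _ => ?_
  simp only [wt, if_neg hk0]
  ring

end HCA
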